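/- arXiv:2312.15433 — 7 statements merged into one kernel-verified Lean document; each statement's English description precedes it below -/
import Mathlib

section
/- Let K ≥ 1, let p be a point of the probability simplex Δ([K]) with p_a > 0 for every a, let ℓ ∈ ℝ^K, and let η > 0 satisfy η·|ℓ_a| ≤ 1 for every a ∈ [K]. Then for every q ∈ Δ([K]), ∑_{a=1}^{K} (p_a − q_a) ℓ_a − (1/η) ∑_{a=1}^{K} q_a log(q_a / p_a) ≤ η ∑_{a=1}^{K} p_a ℓ_a². -/
/-- Young's inequality for the entropy: the convex conjugate of `q ↦ q * log (q / p) - q + p`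
at `y` is at most `p * (exp y - 1)`. -/
theorem mul_sub_mul_log_div_le {p q : ℝ} (hp : 0 < p) (hq : 0 ≤ q) (y : ℝ) :
    q * y - q * Real.log (q / p) ≤ p * Real.exp y - q := by
  rcases hq.eq_or_lt with rfl | hq
  · simpa using mul_nonneg hp.le (Real.exp_pos y).le
  have hlog : Real.log (p * Real.exp y / q) = y - Real.log (q / p) := by
    rw [Real.log_div (by positivity) hq.ne', Real.log_mul hp.ne' (Real.exp_ne_zero y),
      Real.log_exp, Real.log_div hq.ne' hp.ne']
    ring
  have h := Real.log_le_sub_one_of_pos (show 0 < p * Real.exp y / q by positivity)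
  rw [hlog] at h
  calc q * y - q * Real.log (q / p) = q * (y - Real.log (q / p)) := by ring
    _ ≤ q * (p * Real.exp y / q - 1) := by gcongr
    _ = p * Real.exp y - q := by field_simp


/-- Stability inequality for multiplicative-weights / FTRL with Shannon-entropy
regularizer: for `p` in the (strictly positive) probability simplex `Δ([K])`,
losses `ℓ` with `η·|ℓ_a| ≤ 1`, and any `q ∈ Δ([K])`,
`∑ (p_a − q_a) ℓ_a − (1/η) ∑ q_a log(q_a/p_a) ≤ η ∑ p_a ℓ_a²`. -/
theorem mwu_stability (K : ℕ) (hK : 1 ≤ K) (p ℓ : Fin K → ℝ)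
    (hp_pos : ∀ a, 0 < p a) (hp_sum : ∑ a, p a = 1)
    (η : ℝ) (hη : 0 < η) (hηℓ : ∀ a, η * |ℓ a| ≤ 1) :
    ∀ q : Fin K → ℝ, (∀ a, 0 ≤ q a) → ∑ a, q a = 1 →
      (∑ a, (p a - q a) * ℓ a) - (1 / η) * ∑ a, q a * Real.log (q a / p a)
        ≤ η * ∑ a, p a * (ℓ a) ^ 2 := by
  intro q hq hq_sum
  have pointwise : ∀ a, η * ((p a - q a) * ℓ a) - q a * Real.log (q a / p a)
      ≤ η ^ 2 * (p a * ℓ a ^ 2) + (p a - q a) := by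
    intro a
    have habs : |-(η * ℓ a)| ≤ 1 := by
      rw [abs_neg, abs_mul, abs_of_pos hη]
      exact hηℓ a
    have hexp := (abs_le.mp (Real.abs_exp_sub_one_sub_id_le habs)).2
    have hyoung := mul_sub_mul_log_div_le (hp_pos a) (hq a) (-(η * ℓ a))
    have hmul := mul_le_mul_of_nonneg_left hexp (hp_pos a).le
    linarith
  have hsum := Finset.sum_le_sum fun a (_ : a ∈ Finset.univ) => pointwise a
  rw [Finset.sum_sub_distrib, Finset.sum_add_distrib, Finset.sum_sub_distrib, hp_sum, hq_sum,
    sub_self, add_zero, ← Finset.mul_sum, ← Finset.mul_sum] at hsum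
  refine le_of_mul_le_mul_left ?_ hη
  rw [mul_sub, ← mul_assoc η (1 / η), mul_one_div_cancel hη.ne', one_mul, ← mul_assoc, ← sq]
  exact hsum
end

section
/- Let T ≥ 1 and let h_1, h_2, …, h_{T+1} be nonnegative reals with h_1 > 0 and h_t ≤ h_1 for every t ∈ [T+1]. Then ∑_{t=1}^{T} h_{t+1} / sqrt( h_1 + ∑_{s=1}^{t} h_s ) ≤ 2 · sqrt( ∑_{s=1}^{T} h_s ). -/
theorem div_sqrt_le_two_mul_sqrt_add_sub_sqrt {a x c : ℝ} (ha : 0 ≤ a) (hx : 0 ≤ x)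
    (hc : 0 < c) (hac : a + x ≤ c) :
    x / Real.sqrt c ≤ 2 * (Real.sqrt (a + x) - Real.sqrt a) := by
  rw [div_le_iff₀ (Real.sqrt_pos.2 hc)]
  have hu : Real.sqrt (a + x) ≤ Real.sqrt c := Real.sqrt_le_sqrt hac
  have hv : Real.sqrt a ≤ Real.sqrt (a + x) := Real.sqrt_le_sqrt (by linarith)
  have hu2 := Real.sq_sqrt (add_nonneg ha hx)
  have hv2 := Real.sq_sqrt ha
  nlinarith [mul_nonneg (sub_nonneg.2 hv) (sub_nonneg.2 hu),
    sq_nonneg (Real.sqrt (a + x) - Real.sqrt a)]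

theorem sqrt_add_le_sqrt_add_sqrt {a b : ℝ} (ha : 0 ≤ a) (hb : 0 ≤ b) :
    Real.sqrt (a + b) ≤ Real.sqrt a + Real.sqrt b := by
  rw [Real.sqrt_le_left (by positivity)]
  nlinarith [Real.sq_sqrt ha, Real.sq_sqrt hb,
    mul_nonneg (Real.sqrt_nonneg a) (Real.sqrt_nonneg b)]

/-- Telescoping inequality behind the penalty-term lemma: if `0 ≤ h_t ≤ h_1` for
all `t ∈ [T+1]` and `h_1 > 0`, then
`∑_{t=1}^T h_{t+1} / √(h_1 + ∑_{s=1}^t h_s) ≤ 2 √(∑_{s=1}^T h_s)`.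
Here indices are 0-based: `h 0` is the paper's `h_1`. -/
theorem entropy_telescoping (T : ℕ) (hT : 1 ≤ T) (h : ℕ → ℝ)
    (hnonneg : ∀ t, t ≤ T → 0 ≤ h t) (hpos : 0 < h 0)
    (hle : ∀ t, t ≤ T → h t ≤ h 0) :
    ∑ t ∈ Finset.range T,
        h (t + 1) / Real.sqrt (h 0 + ∑ s ∈ Finset.range (t + 1), h s)
      ≤ 2 * Real.sqrt (∑ s ∈ Finset.range T, h s) := by
  have hS : ∀ t, t ≤ T + 1 → 0 ≤ ∑ s ∈ Finset.range t, h s := fun t ht =>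
    Finset.sum_nonneg fun s hs => hnonneg s (by have := Finset.mem_range.1 hs; omega)
  calc
    _ ≤ ∑ t ∈ Finset.range T, (2 * Real.sqrt (∑ s ∈ Finset.range (t + 1 + 1), h s)
          - 2 * Real.sqrt (∑ s ∈ Finset.range (t + 1), h s)) := by
      refine Finset.sum_le_sum fun t ht => ?_
      have htT := Finset.mem_range.1 ht
      have hSt := hS (t + 1) (by omega)
      rw [Finset.sum_range_succ h (t + 1), ← mul_sub]
      exact div_sqrt_le_two_mul_sqrt_add_sub_sqrt hSt (hnonneg _ htT) (by linarith)
        (by linarith [hle (t + 1) htT])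
    _ = 2 * Real.sqrt (∑ s ∈ Finset.range (T + 1), h s) - 2 * Real.sqrt (h 0) := by
      rw [Finset.sum_range_sub (fun t => 2 * Real.sqrt (∑ s ∈ Finset.range (t + 1), h s))]
      simp
    _ ≤ _ := by
      have hsucc : Real.sqrt (∑ s ∈ Finset.range (T + 1), h s)
          ≤ Real.sqrt (∑ s ∈ Finset.range T, h s + h 0) := by
        rw [Finset.sum_range_succ]
        exact Real.sqrt_le_sqrt (by linarith [hle T le_rfl])
      linarith [sqrt_add_le_sqrt_add_sqrt (hS T (by omega)) hpos.le]
end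

section
/- Let c > 0, L > 0, T ≥ 1, and let h_1, …, h_T be reals with 0 ≤ h_t ≤ L for every t. For t ∈ [T] define β'_t = c + ∑_{s=1}^{t−1} c / sqrt( 1 + L^{−1} ∑_{u=1}^{s−1} h_u ). Then ∑_{t=1}^{T} 1/β'_t ≤ ((1 + log T)/c) · sqrt( 1 + L^{−1} ∑_{s=1}^{T} h_s ). -/
/-- Bound on the sum of inverse adaptive FTRL coefficients: with
`β'_t = c + ∑_{s=1}^{t−1} c / √(1 + L⁻¹ ∑_{u=1}^{s−1} h_u)` and `0 ≤ h_t ≤ L`,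
`∑_{t=1}^T 1/β'_t ≤ ((1 + log T)/c) √(1 + L⁻¹ ∑_{s=1}^T h_s)`.
Indices are 0-based: `β t` for `t ∈ range T` is the paper's `β'_{t+1}`. -/
theorem sum_inverse_learning_rates (c L : ℝ) (hc : 0 < c) (hL : 0 < L)
    (T : ℕ) (hT : 1 ≤ T)
    (h : ℕ → ℝ) (hh : ∀ t, t < T → 0 ≤ h t ∧ h t ≤ L)
    (β : ℕ → ℝ)
    (hβ : ∀ t, t < T → β t = c + ∑ s ∈ Finset.range t,
        c / Real.sqrt (1 + L⁻¹ * ∑ u ∈ Finset.range s, h u)) :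
    ∑ t ∈ Finset.range T, 1 / β t
      ≤ ((1 + Real.log T) / c) *
          Real.sqrt (1 + L⁻¹ * ∑ s ∈ Finset.range T, h s) := by
  have hL' : 0 ≤ L⁻¹ := inv_nonneg.mpr hL.le
  set M := Real.sqrt (1 + L⁻¹ * ∑ s ∈ Finset.range T, h s) with hM
  have one_le : ∀ s, s ≤ T → 1 ≤ 1 + L⁻¹ * ∑ u ∈ Finset.range s, h u := fun s hs =>
    le_add_of_nonneg_right <| mul_nonneg hL' <| Finset.sum_nonneg fun u hu =>
      (hh u ((Finset.mem_range.mp hu).trans_le hs)).1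
  have hM1 : 1 ≤ M := Real.one_le_sqrt.mpr (one_le T le_rfl)
  have hM0 : 0 < M := one_pos.trans_le hM1
  have sqrt_le : ∀ s, s ≤ T → Real.sqrt (1 + L⁻¹ * ∑ u ∈ Finset.range s, h u) ≤ M := by
    intro s hs
    refine Real.sqrt_le_sqrt (add_le_add_right (mul_le_mul_of_nonneg_left ?_ hL') 1)
    exact Finset.sum_le_sum_of_subset_of_nonneg (Finset.range_mono hs)
      fun u hu _ => (hh u (Finset.mem_range.mp hu)).1
  have le_β : ∀ t, t < T → ((t : ℝ) + 1) * (c / M) ≤ β t := by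
    intro t ht
    have hsum : (t : ℝ) * (c / M) ≤ ∑ s ∈ Finset.range t,
        c / Real.sqrt (1 + L⁻¹ * ∑ u ∈ Finset.range s, h u) := by
      rw [← nsmul_eq_mul]
      conv_lhs => rw [← Finset.card_range t]
      refine Finset.card_nsmul_le_sum _ _ _ fun s hs => ?_
      have hsT : s ≤ T := ((Finset.mem_range.mp hs).trans ht).le
      exact div_le_div_of_nonneg_left hc.le
        (Real.sqrt_pos.mpr (one_pos.trans_le (one_le s hsT))) (sqrt_le s hsT)
    have hcM : c / M ≤ c := div_le_self hc.le hM1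
    rw [hβ t ht]
    linarith
  calc ∑ t ∈ Finset.range T, 1 / β t
      ≤ ∑ t ∈ Finset.range T, M / c * ((t : ℝ) + 1)⁻¹ := by
        refine Finset.sum_le_sum fun t ht => ?_
        have hpos : 0 < ((t : ℝ) + 1) * (c / M) := by positivity
        refine (one_div_le_one_div_of_le hpos (le_β t (Finset.mem_range.mp ht))).trans_eq ?_
        field_simp
    _ = M / c * (harmonic T : ℝ) := by
        rw [← Finset.mul_sum, harmonic]
        push_cast
        rfl
    _ ≤ M / c * (1 + Real.log T) :=
        mul_le_mul_of_nonneg_left (harmonic_le_one_add_log T) (by positivity)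
    _ = (1 + Real.log T) / c * M := by ring
end

section
/- Let K ≥ 2, T ≥ 1, let p_1, …, p_T ∈ Δ([K]) be probability vectors, let i* ∈ [K], and set ϱ = ∑_{t=1}^{T} (1 − p_t(i*)). If ϱ > 0, then ∑_{t=1}^{T} H(p_t) ≤ ϱ · log( e·K·T / ϱ ). -/
/-- The tangent line of the concave function `x ↦ -x log x` at `y > 0` lies above it. -/
lemma neg_mul_log_le_tangent {x y : ℝ} (hx : 0 ≤ x) (hy : 0 < y) :
    -(x * Real.log x) ≤ x * -Real.log y + y - x := by
  rcases hx.eq_or_lt with rfl | hx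
  · simpa using hy.le
  · have h := mul_le_mul_of_nonneg_left (Real.log_le_sub_one_of_pos (div_pos hy hx)) hx.le
    rw [Real.log_div hy.ne' hx.ne', mul_sub, mul_sub, mul_div_cancel₀ _ hx.ne'] at h
    linarith

/-- The entropy of a probability vector `p` is controlled by its mass off a point `i`. -/
lemma entropy_le_of_mass_off {ι : Type*} [Fintype ι] {p : ι → ℝ}
    (hp : ∀ a, 0 ≤ p a) (hsum : ∑ a, p a = 1) (i : ι) {y : ℝ} (hy : 0 < y) :
    -∑ a, p a * Real.log (p a) ≤ (1 - p i) * -Real.log y + Fintype.card ι * y := by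
  classical
  have hmass : ∑ a ∈ Finset.univ.erase i, p a = 1 - p i := by
    rw [← hsum, ← Finset.add_sum_erase _ p (Finset.mem_univ i)]
    ring
  have hoff : ∑ a ∈ Finset.univ.erase i, -(p a * Real.log (p a)) ≤
      ∑ a ∈ Finset.univ.erase i, (p a * -Real.log y + y - p a) :=
    Finset.sum_le_sum fun a _ => neg_mul_log_le_tangent (hp a) hy
  have hcard : ((Finset.univ.erase i).card : ℝ) * y ≤ Fintype.card ι * y := by
    gcongr
    exact Finset.card_le_univ _
  have hi : -(p i * Real.log (p i)) ≤ 1 - p i := by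
    simpa using neg_mul_log_le_tangent (hp i) one_pos
  rw [Finset.sum_sub_distrib, Finset.sum_add_distrib, ← Finset.sum_mul, hmass,
    Finset.sum_const, nsmul_eq_mul] at hoff
  rw [← Finset.sum_neg_distrib, ← Finset.add_sum_erase _ _ (Finset.mem_univ i)]
  linarith

/-- Cumulative entropy bound: for probability vectors `p_1, …, p_T ∈ Δ([K])` and
`ϱ = ∑_t (1 − p_t(i*)) > 0`, `∑_t H(p_t) ≤ ϱ log(e·K·T/ϱ)`, where
`H(p) = −∑_a p_a log p_a`. -/
theorem sum_entropy_le (K T : ℕ) (hK : 2 ≤ K) (hT : 1 ≤ T)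
    (p : Fin T → Fin K → ℝ)
    (hp_nonneg : ∀ t a, 0 ≤ p t a) (hp_sum : ∀ t, ∑ a, p t a = 1)
    (istar : Fin K) (ϱ : ℝ) (hϱdef : ϱ = ∑ t, (1 - p t istar)) (hϱ : 0 < ϱ) :
    ∑ t, (-∑ a, p t a * Real.log (p t a))
      ≤ ϱ * Real.log (Real.exp 1 * K * T / ϱ) := by
  have hK0 : (0 : ℝ) < K := by exact_mod_cast (by omega : 0 < K)
  have hT0 : (0 : ℝ) < T := by exact_mod_cast (by omega : 0 < T)
  have hy : 0 < ϱ / (K * T) := by positivity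
  have hlog : Real.log (Real.exp 1 * K * T / ϱ) = 1 + -Real.log (ϱ / (K * T)) := by
    rw [← Real.log_inv, inv_div, mul_assoc, mul_div_assoc,
      Real.log_mul (Real.exp_ne_zero 1) (by positivity), Real.log_exp]
  calc ∑ t, (-∑ a, p t a * Real.log (p t a))
      ≤ ∑ t, ((1 - p t istar) * -Real.log (ϱ / (K * T)) + K * (ϱ / (K * T))) :=
        Finset.sum_le_sum fun t _ => by
          simpa only [Fintype.card_fin] using
            entropy_le_of_mass_off (hp_nonneg t) (hp_sum t) istar hy
    _ = ϱ * -Real.log (ϱ / (K * T)) + T * (K * (ϱ / (K * T))) := by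
        rw [Finset.sum_add_distrib, ← Finset.sum_mul, ← hϱdef, Finset.sum_const,
          Finset.card_univ, Fintype.card_fin, nsmul_eq_mul]
    _ = ϱ * Real.log (Real.exp 1 * K * T / ϱ) := by
        rw [hlog, mul_add, mul_one, add_comm]
        congr 1
        field_simp
end

section
/- Let S be a real symmetric positive definite d×d matrix, let T ≥ 1, let X_1, …, X_T ∈ ℝ^d, and for t ∈ [T] set G_t = S + ∑_{j=1}^{t} X_j X_jᵀ. Let R = max_{1 ≤ t ≤ T} X_tᵀ S^{−1} X_t. Then ∑_{t=1}^{T} X_tᵀ G_t^{−1} X_t ≤ d · log( 1 + T·R/d ). -/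
open Matrix

/-- The log-determinant form of the arithmetic-geometric mean inequality for the eigenvalues of a
positive definite matrix. -/
theorem Matrix.PosDef.log_det_le_card_mul_log_trace_div {n : Type*} [Fintype n] [DecidableEq n]
    [Nonempty n] {A : Matrix n n ℝ} (hA : A.PosDef) :
    Real.log A.det ≤ Fintype.card n * Real.log (A.trace / Fintype.card n) := by
  have hcard : (0 : ℝ) < Fintype.card n := by exact_mod_cast Fintype.card_pos
  set c : ℝ := A.trace / Fintype.card n with hc
  have htr : A.trace = ∑ i, hA.isHermitian.eigenvalues i := by
    simpa using hA.isHermitian.trace_eq_sum_eigenvalues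
  have hdet : A.det = ∏ i, hA.isHermitian.eigenvalues i := by
    simpa using hA.isHermitian.det_eq_prod_eigenvalues
  have hpos := hA.eigenvalues_pos
  have hc0 : 0 < c := div_pos hA.trace_pos hcard
  rw [hdet, Real.log_prod fun i _ => (hpos i).ne']
  calc ∑ i, Real.log (hA.isHermitian.eigenvalues i)
      ≤ ∑ i, (hA.isHermitian.eigenvalues i / c - 1 + Real.log c) := by
        refine Finset.sum_le_sum fun i _ => ?_
        have h := Real.log_le_sub_one_of_pos (div_pos (hpos i) hc0)
        rw [Real.log_div (hpos i).ne' hc0.ne'] at h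
        linarith
    _ = Fintype.card n * Real.log c := by
        have h : A.trace / c = Fintype.card n := by
          rw [hc]
          have := hA.trace_pos.ne'
          field_simp
        rw [Finset.sum_add_distrib, Finset.sum_sub_distrib, ← Finset.sum_div, ← htr, h]
        simp

open scoped MatrixOrder Matrix.Norms.L2Operator in
/-- The log-determinant ratio of two positive definite matrices is controlled by a trace. -/
theorem Matrix.PosDef.log_det_sub_log_det_le {n : Type*} [Fintype n] [DecidableEq n]
    [Nonempty n] {A S : Matrix n n ℝ} (hA : A.PosDef) (hS : S.PosDef) :
    Real.log A.det - Real.log S.det ≤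
      Fintype.card n * Real.log ((S⁻¹ * A).trace / Fintype.card n) := by
  obtain ⟨B, hB⟩ := CStarAlgebra.nonneg_iff_eq_star_mul_self.mp hS.inv.posSemidef.nonneg
  rw [star_eq_conjTranspose] at hB
  have hBdet : Bᴴ.det * B.det = S.det⁻¹ := by
    rw [← det_mul, ← hB, det_nonsing_inv, Ring.inverse_eq_inv']
  have hB0 : B.det ≠ 0 := by
    intro h
    rw [h, mul_zero] at hBdet
    exact (inv_pos.mpr hS.det_pos).ne hBdet
  have hM : (B * A * Bᴴ).PosDef := hA.mul_mul_conjTranspose_same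
    (vecMul_injective_iff_isUnit.mpr ((isUnit_iff_isUnit_det B).mpr hB0.isUnit))
  have hdet : (B * A * Bᴴ).det = A.det / S.det := by
    rw [det_mul, det_mul, div_eq_mul_inv, ← hBdet]
    ring
  have htr : (B * A * Bᴴ).trace = (S⁻¹ * A).trace := by
    rw [trace_mul_comm, ← mul_assoc, hB]
  rw [← Real.log_div hA.det_pos.ne' hS.det_pos.ne', ← hdet, ← htr]
  exact hM.log_det_le_card_mul_log_trace_div

/-- A rank-one update increases the log-determinant by at least the quadratic form of the inverse
of the updated matrix. -/
theorem Matrix.PosDef.dotProduct_inv_add_vecMulVec_mulVec_le {n : Type*} [Fintype n]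
    [DecidableEq n] {A : Matrix n n ℝ} (hA : A.PosDef) (x : n → ℝ) :
    x ⬝ᵥ (A + vecMulVec x x)⁻¹.mulVec x ≤
      Real.log (A + vecMulVec x x).det - Real.log A.det := by
  have hB : (A + vecMulVec x x).PosDef :=
    hA.add_posSemidef (by simpa using posSemidef_vecMulVec_self_star x)
  set B := A + vecMulVec x x with hBdef
  have hdet : A.det = B.det * (1 - x ⬝ᵥ B⁻¹.mulVec x) := by
    have h := det_add_replicateCol_mul_replicateRow (ι := Unit) hB.det_pos.ne'.isUnit (-x) x
    rw [← vecMulVec_eq, neg_vecMulVec, hBdef, add_neg_cancel_right, ← hBdef,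
      Matrix.mul_assoc, det_unique (n := Unit)] at h
    rw [h, ← replicateCol_mulVec, add_apply, one_apply_eq,
      replicateRow_mul_replicateCol_apply, mulVec_neg, dotProduct_neg, sub_eq_add_neg]
  have hq : 0 < 1 - x ⬝ᵥ B⁻¹.mulVec x :=
    pos_of_mul_pos_right (hdet ▸ hA.det_pos) hB.det_pos.le
  have hlog := Real.log_le_sub_one_of_pos hq
  rw [hdet, Real.log_mul hB.det_pos.ne' hq.ne']
  linarith

/-- Elliptical potential lemma: for symmetric positive definite `S`, vectors
`X_1, …, X_T`, `G_t = S + ∑_{j=1}^t X_j X_jᵀ`, and `R = max_t X_tᵀ S⁻¹ X_t`,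
`∑_{t=1}^T X_tᵀ G_t⁻¹ X_t ≤ d log(1 + T·R/d)`.
Rounds are 0-indexed: `t ∈ range T` is the paper's round `t+1`. -/
theorem elliptical_potential (d : ℕ) (hd : 1 ≤ d) (T : ℕ) (hT : 1 ≤ T)
    (S : Matrix (Fin d) (Fin d) ℝ) (hS : S.PosDef)
    (X : ℕ → Fin d → ℝ)
    (G : ℕ → Matrix (Fin d) (Fin d) ℝ)
    (hG : ∀ t, t < T →
      G t = S + ∑ j ∈ Finset.range (t + 1), Matrix.vecMulVec (X j) (X j))
    (R : ℝ)
    (hR : R = (Finset.range T).sup'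
        (Finset.nonempty_range_iff.mpr (by omega))
        (fun t => X t ⬝ᵥ S⁻¹.mulVec (X t))) :
    ∑ t ∈ Finset.range T, X t ⬝ᵥ (G t)⁻¹.mulVec (X t)
      ≤ d * Real.log (1 + T * R / d) := by
  have : Nonempty (Fin d) := ⟨⟨0, hd⟩⟩
  have hd0 : (0 : ℝ) < d := by exact_mod_cast hd
  set H : ℕ → Matrix (Fin d) (Fin d) ℝ := fun k =>
    S + ∑ j ∈ Finset.range k, vecMulVec (X j) (X j) with hH
  have hHpos (k : ℕ) : (H k).PosDef :=
    hS.add_posSemidef (posSemidef_sum _ fun j _ => by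
      simpa using posSemidef_vecMulVec_self_star (X j))
  have hsucc (k : ℕ) : H (k + 1) = H k + vecMulVec (X k) (X k) := by
    simp only [hH, Finset.sum_range_succ, add_assoc]
  have htrace : (S⁻¹ * H T).trace =
      d + ∑ t ∈ Finset.range T, X t ⬝ᵥ S⁻¹.mulVec (X t) := by
    simp only [hH, mul_add, nonsing_inv_mul S hS.det_pos.ne'.isUnit, trace_add, trace_one,
      Fintype.card_fin, Finset.mul_sum, trace_sum, mul_vecMulVec, trace_vecMulVec]
    simp only [dotProduct_comm]
  have hsum_nonneg : 0 ≤ ∑ t ∈ Finset.range T, X t ⬝ᵥ S⁻¹.mulVec (X t) :=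
    Finset.sum_nonneg fun t _ => by
      simpa using hS.inv.posSemidef.dotProduct_mulVec_nonneg (X t)
  have hsum_le : ∑ t ∈ Finset.range T, X t ⬝ᵥ S⁻¹.mulVec (X t) ≤ T * R := by
    have h := Finset.sum_le_card_nsmul (Finset.range T)
      (fun t => X t ⬝ᵥ S⁻¹.mulVec (X t)) R fun t ht => by
        rw [hR]
        exact Finset.le_sup' (fun t => X t ⬝ᵥ S⁻¹.mulVec (X t)) ht
    simpa using h
  calc ∑ t ∈ Finset.range T, X t ⬝ᵥ (G t)⁻¹.mulVec (X t)
      ≤ ∑ t ∈ Finset.range T, (Real.log (H (t + 1)).det - Real.log (H t).det) := by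
        refine Finset.sum_le_sum fun t ht => ?_
        rw [hG t (Finset.mem_range.mp ht)]
        change X t ⬝ᵥ (H (t + 1))⁻¹.mulVec (X t) ≤ _
        rw [hsucc]
        exact (hHpos t).dotProduct_inv_add_vecMulVec_mulVec_le (X t)
    _ = Real.log (H T).det - Real.log S.det := by
        rw [Finset.sum_range_sub fun t => Real.log (H t).det]
        simp [hH]
    _ ≤ d * Real.log ((S⁻¹ * H T).trace / d) := by
        simpa using (hHpos T).log_det_sub_log_det_le hS
    _ ≤ d * Real.log (1 + T * R / d) := by
        rw [htrace, add_div, div_self hd0.ne']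
        gcongr
end

section
/- Let d ≥ 1, T ≥ 1, let M ⊆ ℝ^d be a nonempty closed convex set, let S be a real symmetric positive definite d×d matrix, and let X_1, …, X_T ∈ ℝ^d, θ_1, …, θ_T ∈ ℝ^d, and c_1, …, c_T ∈ {0,1}. Assume |⟨X_t, m⟩| ≤ 1 for every t ∈ [T] and every m ∈ M, and |⟨X_t, θ_t⟩| ≤ 1 for every t ∈ [T]. For t ∈ {0,1,…,T} define F_t(m) = (1/2)‖m‖_S² + (1/2)∑_{j=1}^{t} c_j ⟨θ_j − m, X_j⟩², and suppose m_t ∈ M minimizes F_{t−1} over M for each t ∈ [T+1]. Set G_t = S + ∑_{j=1}^{t} c_j X_j X_jᵀ. Then for every m* ∈ M, ∑_{t=1}^{T} c_t ⟨θ_t − m_t, X_t⟩² ≤ ∑_{t=1}^{T} c_t ⟨θ_t − m*, X_t⟩² + ‖m*‖_S² + 8 ∑_{t=1}^{T} c_t ‖X_t‖²_{G_t^{−1}}. -/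
open Matrix

/-- A quadratic polynomial that is minimal at `0` on `[0, 1]` has nonnegative linear coefficient. -/
theorem linear_coeff_nonneg_of_min_at_zero {a b : ℝ}
    (h : ∀ r : ℝ, 0 ≤ r → r ≤ 1 → 0 ≤ r * b + r ^ 2 * a) : 0 ≤ b := by
  by_contra! hb
  have hden : 0 < |a| - b := by linarith [abs_nonneg a]
  set r := -b / (2 * (|a| - b)) with hr
  have hr0 : 0 < r := by apply div_pos <;> linarith
  have hr1 : r ≤ 1 := by
    rw [hr, div_le_one (by linarith)]
    linarith [abs_nonneg a]
  have hmul : r * (2 * (|a| - b)) = -b := div_mul_cancel₀ _ (by linarith)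
  have h1 : 0 ≤ r * (b + r * a) := by linarith [h r hr0.le hr1]
  have h2 : 0 ≤ b + r * a := nonneg_of_mul_nonneg_right h1 hr0
  have h3 : r * a ≤ r * |a| := mul_le_mul_of_nonneg_left (le_abs_self a) hr0.le
  nlinarith

/-- The weighted Gram matrix `S + ∑ c_j X_j X_jᵀ` is positive definite if `S` is. -/
theorem posDef_add_sum_smul_vecMulVec {n ι : Type*} [Fintype n]
    {S : Matrix n n ℝ} (hS : S.PosDef) (s : Finset ι) (X : ι → n → ℝ) (c : ι → ℝ)
    (hc : ∀ j ∈ s, 0 ≤ c j) :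
    (S + ∑ j ∈ s, c j • vecMulVec (X j) (X j)).PosDef := by
  refine hS.add_posSemidef (posSemidef_sum s fun j hj => ?_)
  have h := posSemidef_vecMulVec_self_star (X j)
  rw [star_trivial] at h
  exact h.smul (hc j hj)

/-- The quadratic form of the weighted Gram matrix `S + ∑ c_j X_j X_jᵀ`. -/
theorem dotProduct_add_sum_smul_vecMulVec_mulVec {n ι : Type*} [Fintype n]
    (S : Matrix n n ℝ) (s : Finset ι) (X : ι → n → ℝ) (c : ι → ℝ) (v : n → ℝ) :
    v ⬝ᵥ (S + ∑ j ∈ s, c j • vecMulVec (X j) (X j)) *ᵥ v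
      = v ⬝ᵥ S *ᵥ v + ∑ j ∈ s, c j * (v ⬝ᵥ X j) ^ 2 := by
  rw [add_mulVec, dotProduct_add, sum_mulVec, dotProduct_sum]
  congr 1
  refine Finset.sum_congr rfl fun j _ => ?_
  rw [smul_mulVec, vecMulVec_mulVec, dotProduct_smul, op_smul_eq_smul, dotProduct_smul,
    dotProduct_comm (X j) v, smul_eq_mul, smul_eq_mul, sq]

/-- The bilinear form of a real symmetric matrix is symmetric. -/
theorem dotProduct_mulVec_comm_of_isHermitian {n : Type*} [Fintype n] {A : Matrix n n ℝ}
    (hA : A.IsHermitian) (u v : n → ℝ) : u ⬝ᵥ A *ᵥ v = v ⬝ᵥ A *ᵥ u := by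
  have hAt : Aᵀ = A := by rw [← conjTranspose_eq_transpose_of_trivial]; exact hA
  rw [dotProduct_mulVec, ← mulVec_transpose, hAt, dotProduct_comm]

/-- Expansion of the quadratic form of a real symmetric matrix along a line. -/
theorem dotProduct_mulVec_add_smul {n : Type*} [Fintype n] {A : Matrix n n ℝ}
    (hA : A.IsHermitian) (u v : n → ℝ) (r : ℝ) :
    (u + r • v) ⬝ᵥ A *ᵥ (u + r • v)
      = u ⬝ᵥ A *ᵥ u + 2 * r * (v ⬝ᵥ A *ᵥ u) + r ^ 2 * (v ⬝ᵥ A *ᵥ v) := by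
  simp only [mulVec_add, mulVec_smul, dotProduct_add, add_dotProduct, dotProduct_smul,
    smul_dotProduct, smul_eq_mul, dotProduct_mulVec_comm_of_isHermitian hA u v]
  ring

/-- Fenchel–Young inequality for the quadratic form of a positive definite matrix. -/
theorem two_mul_dotProduct_le_of_posDef {n : Type*} [Fintype n] [DecidableEq n]
    {A : Matrix n n ℝ} (hA : A.PosDef) (v x : n → ℝ) (a : ℝ) :
    2 * a * (v ⬝ᵥ x) ≤ v ⬝ᵥ A *ᵥ v + a ^ 2 * (x ⬝ᵥ A⁻¹ *ᵥ x) := by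
  have hinv : A *ᵥ (A⁻¹ *ᵥ x) = x := by
    rw [mulVec_mulVec, mul_nonsing_inv _ ((isUnit_iff_isUnit_det A).1 hA.isUnit), one_mulVec]
  have h := hA.posSemidef.dotProduct_mulVec_nonneg (v + (-a) • A⁻¹ *ᵥ x)
  rw [star_trivial, dotProduct_mulVec_add_smul hA.isHermitian,
    dotProduct_mulVec_comm_of_isHermitian hA.isHermitian (A⁻¹ *ᵥ x) v, hinv,
    dotProduct_comm (A⁻¹ *ᵥ x) x] at h
  linarith

/-- Minimizers of a weighted ridge objective over a convex set satisfy quadratic growth. -/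
theorem ridge_quadratic_growth {n ι : Type*} [Fintype n] {S : Matrix n n ℝ}
    (hS : S.IsHermitian) (s : Finset ι) (X θ : ι → n → ℝ) (c : ι → ℝ)
    {F : (n → ℝ) → ℝ}
    (hF : ∀ m, F m = (1 / 2) * (m ⬝ᵥ S *ᵥ m)
      + (1 / 2) * ∑ j ∈ s, c j * ((θ j - m) ⬝ᵥ X j) ^ 2)
    {M : Set (n → ℝ)} (hM : Convex ℝ M) {u v : n → ℝ} (hu : u ∈ M) (hv : v ∈ M)
    (hmin : ∀ w ∈ M, F u ≤ F w) :
    F u + (1 / 2) * ((v - u) ⬝ᵥ S *ᵥ (v - u) + ∑ j ∈ s, c j * ((v - u) ⬝ᵥ X j) ^ 2)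
      ≤ F v := by
  set δ := v - u with hδ
  set b := δ ⬝ᵥ S *ᵥ u - ∑ j ∈ s, c j * ((θ j - u) ⬝ᵥ X j) * (δ ⬝ᵥ X j) with hb
  set q := δ ⬝ᵥ S *ᵥ δ + ∑ j ∈ s, c j * (δ ⬝ᵥ X j) ^ 2 with hq
  have expand : ∀ r : ℝ, F (u + r • δ) = F u + (r * b + r ^ 2 * (q / 2)) := by
    intro r
    have hsum : ∑ j ∈ s, c j * ((θ j - (u + r • δ)) ⬝ᵥ X j) ^ 2
        = ∑ j ∈ s, c j * ((θ j - u) ⬝ᵥ X j) ^ 2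
          - 2 * r * ∑ j ∈ s, c j * ((θ j - u) ⬝ᵥ X j) * (δ ⬝ᵥ X j)
          + r ^ 2 * ∑ j ∈ s, c j * (δ ⬝ᵥ X j) ^ 2 := by
      rw [Finset.mul_sum, Finset.mul_sum, ← Finset.sum_sub_distrib, ← Finset.sum_add_distrib]
      refine Finset.sum_congr rfl fun j _ => ?_
      rw [← sub_sub, sub_dotProduct (θ j - u), smul_dotProduct, smul_eq_mul]
      ring
    rw [hF, hF, dotProduct_mulVec_add_smul hS, hsum, hb, hq]
    ring
  have hb0 : 0 ≤ b := by
    refine linear_coeff_nonneg_of_min_at_zero (a := q / 2) fun r h0 h1 => ?_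
    have := hmin _ (hM.add_smul_sub_mem hu hv ⟨h0, h1⟩)
    rw [← hδ, expand] at this
    linarith
  have h1 := expand 1
  rw [one_smul, hδ, add_sub_cancel] at h1
  linarith

/-- Follow-the-leader regret bound for online ridge regression with squared loss
(eq. `squaredloss_bound_eachaction`): for a 0/1 indicator sequence `c_t`,
`∑_t c_t ⟨θ_t − m_t, X_t⟩² ≤ ∑_t c_t ⟨θ_t − m*, X_t⟩² + ‖m*‖_S²
  + 8 ∑_t c_t ‖X_t‖²_{G_t⁻¹}`,
where `m_t` minimizes `F_{t−1}` over `M` and `G_t = S + ∑_{j≤t} c_j X_j X_jᵀ`.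
Rounds are 0-indexed: `t ∈ range T` is the paper's round `t+1`, and `F t` (resp.
`m t`) here is the paper's `F_t` (resp. `m_{t+1}`, the minimizer of `F_t`). -/
theorem ftl_ridge_regret (d T : ℕ) (hd : 1 ≤ d) (hT : 1 ≤ T)
    (M : Set (Fin d → ℝ)) (hMne : M.Nonempty) (hMclosed : IsClosed M)
    (hMconvex : Convex ℝ M)
    (S : Matrix (Fin d) (Fin d) ℝ) (hS : S.PosDef)
    (X θ : ℕ → Fin d → ℝ) (c : ℕ → ℝ)
    (hc : ∀ t, t < T → c t = 0 ∨ c t = 1)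
    (hXM : ∀ t, t < T → ∀ m ∈ M, |X t ⬝ᵥ m| ≤ 1)
    (hXθ : ∀ t, t < T → |X t ⬝ᵥ θ t| ≤ 1)
    (F : ℕ → (Fin d → ℝ) → ℝ)
    (hF : ∀ k m, F k m = (1 / 2) * (m ⬝ᵥ S.mulVec m)
        + (1 / 2) * ∑ j ∈ Finset.range k, c j * ((θ j - m) ⬝ᵥ X j) ^ 2)
    (m : ℕ → Fin d → ℝ)
    (hm : ∀ t, t ≤ T → m t ∈ M ∧ ∀ m' ∈ M, F t (m t) ≤ F t m')
    (G : ℕ → Matrix (Fin d) (Fin d) ℝ)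
    (hG : ∀ t, t < T →
      G t = S + ∑ j ∈ Finset.range (t + 1), c j • Matrix.vecMulVec (X j) (X j)) :
    ∀ mstar ∈ M,
      ∑ t ∈ Finset.range T, c t * ((θ t - m t) ⬝ᵥ X t) ^ 2
        ≤ ∑ t ∈ Finset.range T, c t * ((θ t - mstar) ⬝ᵥ X t) ^ 2
          + mstar ⬝ᵥ S.mulVec mstar
          + 8 * ∑ t ∈ Finset.range T, c t * (X t ⬝ᵥ (G t)⁻¹.mulVec (X t)) := by
  intro mstar hmstar
  have hc0 : ∀ t, t < T → 0 ≤ c t := fun t ht => by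
    rcases hc t ht with h | h <;> simp [h]
  have step : ∀ t, t < T →
      F t (m t) + (1 / 2) * (c t * ((θ t - m t) ⬝ᵥ X t) ^ 2)
        ≤ F (t + 1) (m (t + 1)) + 4 * (c t * (X t ⬝ᵥ (G t)⁻¹ *ᵥ X t)) := by
    intro t ht
    obtain ⟨hmt, hmin⟩ := hm t ht.le
    obtain ⟨hmt', -⟩ := hm (t + 1) ht
    have hsucc : F (t + 1) (m (t + 1)) = F t (m (t + 1))
        + (1 / 2) * (c t * ((θ t - m (t + 1)) ⬝ᵥ X t) ^ 2) := by
      rw [hF, hF, Finset.sum_range_succ]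
      ring
    rcases hc t ht with h | h
    · rw [hsucc, h]
      linarith [hmin _ hmt']
    have hGpos : (G t).PosDef := by
      rw [hG t ht]
      exact posDef_add_sum_smul_vecMulVec hS _ X c fun j hj =>
        hc0 j (by have := Finset.mem_range.1 hj; omega)
    have hgrowth := ridge_quadratic_growth hS.isHermitian _ X θ c (hF t) hMconvex hmt hmt' hmin
    set δ := m (t + 1) - m t with hδ
    have hquad : δ ⬝ᵥ G t *ᵥ δ = δ ⬝ᵥ S *ᵥ δ
        + ∑ j ∈ Finset.range t, c j * (δ ⬝ᵥ X j) ^ 2 + (δ ⬝ᵥ X t) ^ 2 := by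
      rw [hG t ht, dotProduct_add_sum_smul_vecMulVec_mulVec, Finset.sum_range_succ, h]
      ring
    set a := (θ t - m t) ⬝ᵥ X t with ha
    have hnext : (θ t - m (t + 1)) ⬝ᵥ X t = a - δ ⬝ᵥ X t := by
      rw [ha, hδ, ← sub_dotProduct, sub_sub_sub_cancel_right]
    have ha2 : a ^ 2 ≤ 4 := by
      have h1 := abs_le.1 (hXM t ht _ hmt)
      have h2 := abs_le.1 (hXθ t ht)
      have h3 : a = X t ⬝ᵥ θ t - X t ⬝ᵥ m t := by
        rw [ha, sub_dotProduct, dotProduct_comm, dotProduct_comm (m t)]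
      nlinarith
    have hs : 0 ≤ X t ⬝ᵥ (G t)⁻¹ *ᵥ X t := by
      simpa using hGpos.inv.posSemidef.dotProduct_mulVec_nonneg (X t)
    have hyoung := two_mul_dotProduct_le_of_posDef hGpos δ (X t) a
    have hscale := mul_le_mul_of_nonneg_right ha2 hs
    rw [hsucc, hnext, h]
    linarith
  have telescope : ∀ k, k ≤ T →
      F 0 (m 0) + (1 / 2) * ∑ t ∈ Finset.range k, c t * ((θ t - m t) ⬝ᵥ X t) ^ 2
        ≤ F k (m k) + 4 * ∑ t ∈ Finset.range k, c t * (X t ⬝ᵥ (G t)⁻¹ *ᵥ X t) := by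
    intro k
    induction k with
    | zero => simp
    | succ k ih =>
      intro hk
      rw [Finset.sum_range_succ, Finset.sum_range_succ]
      linarith [ih (by omega), step k hk]
  have hF0 : 0 ≤ F 0 (m 0) := by
    have := hS.posSemidef.dotProduct_mulVec_nonneg (m 0)
    rw [star_trivial] at this
    rw [hF, Finset.range_zero, Finset.sum_empty]
    linarith
  have hfinal := (hm T le_rfl).2 mstar hmstar
  rw [hF T mstar] at hfinal
  linarith [telescope T le_rfl]
end

section
/- Let d ≥ 1, K ≥ 1, T ≥ 1, let X ⊆ ℝ^d, let M = {m ∈ ℝ^d : |⟨x, m⟩| ≤ 1 for all x ∈ X} be nonempty and closed, and let S be a real symmetric positive definite d×d matrix. Let X_1, …, X_T ∈ X, actions A_1, …, A_T ∈ [K], and vectors θ_{t,a} ∈ ℝ^d for t ∈ [T], a ∈ [K], with |⟨X_t, θ_{t,a}⟩| ≤ 1 for all t and a. For each t ∈ [T] and a ∈ [K], suppose m_{t,a} ∈ M minimizes m ↦ ‖m‖_S² + ∑_{j=1}^{t−1} 1{A_j = a} ⟨θ_{j,a} − m, X_j⟩² over M. Then for every m* ∈ M, ∑_{t=1}^{T}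 ⟨θ_{t,A_t} − m_{t,A_t}, X_t⟩² ≤ ∑_{t=1}^{T} ⟨θ_{t,A_t} − m*, X_t⟩² + K ‖m*‖_S² + 8 K d log( 1 + (T/d) · max_{1 ≤ t ≤ T} ‖X_t‖²_{S^{−1}} ). -/
open Matrix

section RidgeRegression

variable {ι : Type*}

/-- The regularized Gram matrix of the first `n` covariates. -/
def ridgeGram (S : Matrix ι ι ℝ) (x : ℕ → ι → ℝ) (n : ℕ) : Matrix ι ι ℝ :=
  S + ∑ j ∈ Finset.range n, vecMulVec (x j) (x j)

lemma ridgeGram_succ (S : Matrix ι ι ℝ) (x : ℕ → ι → ℝ) (n : ℕ) :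
    ridgeGram S x (n + 1) = ridgeGram S x n + vecMulVec (x n) (x n) := by
  simp [ridgeGram, Finset.sum_range_succ, add_assoc]

variable [Fintype ι]

/-- The ridge-regression objective after the first `n` observations. -/
def ridgeObjective (S : Matrix ι ι ℝ) (x : ℕ → ι → ℝ) (y : ℕ → ℝ) (n : ℕ) (m : ι → ℝ) : ℝ :=
  m ⬝ᵥ S *ᵥ m + ∑ j ∈ Finset.range n, (y j - m ⬝ᵥ x j) ^ 2

lemma dotProduct_vecMulVec_mulVec_self (u v : ι → ℝ) :
    u ⬝ᵥ vecMulVec v v *ᵥ u = (u ⬝ᵥ v) ^ 2 := by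
  rw [vecMulVec_mulVec, dotProduct_comm v u]
  simp [dotProduct_smul, sq]

lemma ridgeGram_posDef {S : Matrix ι ι ℝ} (hS : S.PosDef) (x : ℕ → ι → ℝ) (n : ℕ) :
    (ridgeGram S x n).PosDef := by
  induction n with
  | zero => simpa [ridgeGram] using hS
  | succ n ih =>
    rw [ridgeGram_succ]
    refine ih.add_posSemidef ?_
    simpa using posSemidef_vecMulVec_self_star (x n)

lemma dotProduct_ridgeGram_mulVec (S : Matrix ι ι ℝ) (x : ℕ → ι → ℝ) (n : ℕ) (u : ι → ℝ) :
    u ⬝ᵥ ridgeGram S x n *ᵥ u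
      = u ⬝ᵥ S *ᵥ u + ∑ j ∈ Finset.range n, (u ⬝ᵥ x j) ^ 2 := by
  induction n with
  | zero => simp [ridgeGram]
  | succ n ih =>
    rw [ridgeGram_succ, add_mulVec, dotProduct_add, ih, dotProduct_vecMulVec_mulVec_self,
      Finset.sum_range_succ, add_assoc]

lemma ridgeObjective_add_smul (S : Matrix ι ι ℝ) (x : ℕ → ι → ℝ) (y : ℕ → ℝ) (n : ℕ)
    (m u : ι → ℝ) (s : ℝ) :
    ridgeObjective S x y n (m + s • u) = ridgeObjective S x y n m
      + s * (m ⬝ᵥ S *ᵥ u + u ⬝ᵥ S *ᵥ m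
          - ∑ j ∈ Finset.range n, 2 * (y j - m ⬝ᵥ x j) * (u ⬝ᵥ x j))
      + s ^ 2 * (u ⬝ᵥ ridgeGram S x n *ᵥ u) := by
  have hsum : ∑ j ∈ Finset.range n, (y j - (m + s • u) ⬝ᵥ x j) ^ 2
      = ∑ j ∈ Finset.range n, (y j - m ⬝ᵥ x j) ^ 2
        - s * ∑ j ∈ Finset.range n, 2 * (y j - m ⬝ᵥ x j) * (u ⬝ᵥ x j)
        + s ^ 2 * ∑ j ∈ Finset.range n, (u ⬝ᵥ x j) ^ 2 := by
    rw [Finset.mul_sum, Finset.mul_sum, ← Finset.sum_sub_distrib, ← Finset.sum_add_distrib]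
    refine Finset.sum_congr rfl fun j _ => ?_
    rw [add_dotProduct, smul_dotProduct, smul_eq_mul]
    ring
  rw [dotProduct_ridgeGram_mulVec, ridgeObjective, ridgeObjective, hsum]
  simp only [mulVec_add, mulVec_smul, add_dotProduct, dotProduct_add, smul_dotProduct,
    dotProduct_smul, smul_eq_mul]
  ring

/-- An affine-plus-quadratic function that is nonnegative on `(0, 1]` has nonnegative slope at
the origin. -/
lemma nonneg_of_forall_mul_add_sq_mul_nonneg {L Q : ℝ}
    (h : ∀ s : ℝ, 0 < s → s ≤ 1 → 0 ≤ s * L + s ^ 2 * Q) : 0 ≤ L := by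
  by_contra! hL
  have hden : 0 < |Q| + |L| + 1 := by positivity
  have hL' : 0 < |L| := abs_pos.mpr hL.ne
  set s := |L| / (|Q| + |L| + 1) with hs
  have hs0 : 0 < s := by positivity
  have hs1 : s ≤ 1 := by
    rw [hs, div_le_one hden]
    linarith [abs_nonneg Q]
  have hsL : s * (|Q| + |L| + 1) = |L| := div_mul_cancel₀ _ hden.ne'
  have h1 : 0 ≤ s * (L + s * Q) := by
    linarith [h s hs0 hs1, show s * (L + s * Q) = s * L + s ^ 2 * Q by ring]
  have h2 : 0 ≤ L + s * Q := nonneg_of_mul_nonneg_right h1 hs0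
  have h3 : s * Q ≤ s * |Q| := by gcongr; exact le_abs_self Q
  have h4 : 0 < s * (|L| + 1) := by positivity
  have h5 := abs_of_neg hL
  linarith [show s * (|Q| + |L| + 1) = s * |Q| + s * (|L| + 1) by ring]

/-- Quadratic growth of the ridge objective around a constrained minimizer. -/
lemma ridgeObjective_add_le_of_isMinOn {M : Set (ι → ℝ)} (hM : Convex ℝ M)
    {S : Matrix ι ι ℝ} {x : ℕ → ι → ℝ} {y : ℕ → ℝ} {n : ℕ} {m₀ m : ι → ℝ}
    (hm₀ : m₀ ∈ M) (hmin : IsMinOn (ridgeObjective S x y n) M m₀) (hm : m ∈ M) :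
    ridgeObjective S x y n m₀ + (m - m₀) ⬝ᵥ ridgeGram S x n *ᵥ (m - m₀)
      ≤ ridgeObjective S x y n m := by
  have hexp := ridgeObjective_add_smul S x y n m₀ (m - m₀)
  have hL : 0 ≤ m₀ ⬝ᵥ S *ᵥ (m - m₀) + (m - m₀) ⬝ᵥ S *ᵥ m₀
      - ∑ j ∈ Finset.range n, 2 * (y j - m₀ ⬝ᵥ x j) * ((m - m₀) ⬝ᵥ x j) := by
    refine nonneg_of_forall_mul_add_sq_mul_nonneg
      (Q := (m - m₀) ⬝ᵥ ridgeGram S x n *ᵥ (m - m₀)) fun s hs0 hs1 => ?_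
    have hle := isMinOn_iff.mp hmin _ (hM.add_smul_sub_mem hm₀ hm ⟨hs0.le, hs1⟩)
    rw [hexp s] at hle
    linarith
  have h1 := hexp 1
  rw [one_smul, add_sub_cancel] at h1
  linarith

variable [DecidableEq ι]

/-- Completing the square in the norm induced by a positive definite matrix. -/
lemma Matrix.PosDef.two_mul_dotProduct_le {B : Matrix ι ι ℝ} (hB : B.PosDef)
    (u v : ι → ℝ) (r : ℝ) :
    2 * r * (u ⬝ᵥ v) ≤ u ⬝ᵥ B *ᵥ u + r ^ 2 * (v ⬝ᵥ B⁻¹ *ᵥ v) := by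
  have hinv : B *ᵥ (B⁻¹ *ᵥ v) = v := by
    rw [mulVec_mulVec, mul_nonsing_inv _ hB.det_pos.ne'.isUnit, one_mulVec]
  have hT : Bᵀ = B := by simpa using hB.isHermitian.eq
  have hsymm : (B⁻¹ *ᵥ v) ⬝ᵥ B *ᵥ u = u ⬝ᵥ v := by
    rw [dotProduct_mulVec, ← mulVec_transpose, hT, hinv, dotProduct_comm]
  have h := hB.posSemidef.dotProduct_mulVec_nonneg (u - r • (B⁻¹ *ᵥ v))
  simp only [star_trivial, mulVec_sub, mulVec_smul, hinv, sub_dotProduct, dotProduct_sub,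
    smul_dotProduct, dotProduct_smul, smul_eq_mul, hsymm,
    dotProduct_comm (B⁻¹ *ᵥ v) v] at h
  linarith

lemma det_sub_vecMulVec_self {B : Matrix ι ι ℝ} (hB : IsUnit B.det) (v : ι → ℝ) :
    (B - vecMulVec v v).det = B.det * (1 - v ⬝ᵥ B⁻¹ *ᵥ v) := by
  have h := det_add_replicateCol_mul_replicateRow (ι := Unit) hB (-v) v
  rw [sub_eq_add_neg, ← neg_vecMulVec, vecMulVec_eq Unit, h, det_unique (n := Unit)]
  simp [Matrix.mul_apply, dotProduct, mulVec, Finset.sum_mul, Finset.mul_sum, mul_assoc,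
    sub_eq_add_neg]
  exact Or.inl Finset.sum_comm

/-- One step of the elliptical potential argument. -/
lemma dotProduct_inv_mulVec_le_log_det_sub {B : Matrix ι ι ℝ} (hB : B.PosDef) (v : ι → ℝ)
    (hB' : (B + vecMulVec v v).PosDef) :
    v ⬝ᵥ (B + vecMulVec v v)⁻¹ *ᵥ v
      ≤ Real.log (B + vecMulVec v v).det - Real.log B.det := by
  have hdet := det_sub_vecMulVec_self hB'.det_pos.ne'.isUnit v
  rw [add_sub_cancel_right] at hdet
  have hpos : 0 < 1 - v ⬝ᵥ (B + vecMulVec v v)⁻¹ *ᵥ v :=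
    pos_of_mul_pos_right (hdet ▸ hB.det_pos) hB'.det_pos.le
  have hlog := Real.log_le_sub_one_of_pos hpos
  rw [hdet, Real.log_mul hB'.det_pos.ne' hpos.ne']
  linarith

/-- Pathwise regret bound for online ridge regression over a convex set. -/
lemma sum_sq_residual_le_ridgeObjective_add_log_det {M : Set (ι → ℝ)} (hM : Convex ℝ M)
    {S : Matrix ι ι ℝ} (hS : S.PosDef) {x : ℕ → ι → ℝ} {y : ℕ → ℝ} {n : ℕ} {p : ℕ → ι → ℝ}
    (hp : ∀ t < n, p t ∈ M) (hmin : ∀ t < n, IsMinOn (ridgeObjective S x y t) M (p t))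
    {R : ℝ} (hR : ∀ t < n, (y t - p t ⬝ᵥ x t) ^ 2 ≤ R) {m : ι → ℝ} (hm : m ∈ M) :
    ∑ t ∈ Finset.range n, (y t - p t ⬝ᵥ x t) ^ 2
      ≤ ridgeObjective S x y n m
        + R * (Real.log (ridgeGram S x n).det - Real.log S.det) := by
  induction n generalizing m with
  | zero =>
    simpa [ridgeObjective, ridgeGram] using hS.posSemidef.dotProduct_mulVec_nonneg m
  | succ n ih =>
    have hn := Nat.lt_succ_self n
    have ih' := ih (fun t ht => hp t (ht.trans hn)) (fun t ht => hmin t (ht.trans hn))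
      (fun t ht => hR t (ht.trans hn)) (hp n hn)
    have hgrow := ridgeObjective_add_le_of_isMinOn hM (hp n hn) (hmin n hn) hm
    have hB' := ridgeGram_posDef hS x (n + 1)
    have hsq := hB'.two_mul_dotProduct_le (m - p n) (x n) (y n - p n ⬝ᵥ x n)
    have hq0 := hB'.inv.posSemidef.dotProduct_mulVec_nonneg (x n)
    rw [star_trivial] at hq0
    have hlog := dotProduct_inv_mulVec_le_log_det_sub (ridgeGram_posDef hS x n) (x n)
      (ridgeGram_succ S x n ▸ hB')
    rw [← ridgeGram_succ] at hlog
    have hRq := mul_le_mul (hR n hn) hlog hq0 ((sq_nonneg _).trans (hR n hn))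
    have hobj : ridgeObjective S x y (n + 1) m
        = ridgeObjective S x y n m + (y n - m ⬝ᵥ x n) ^ 2 := by
      simp [ridgeObjective, Finset.sum_range_succ, add_assoc]
    rw [ridgeGram_succ S x n, add_mulVec, dotProduct_add, dotProduct_vecMulVec_mulVec_self,
      ← ridgeGram_succ S x n, sub_dotProduct] at hsq
    rw [Finset.sum_range_succ, hobj]
    linarith

/-- The AM-GM inequality between determinant and trace. -/
lemma Matrix.PosSemidef.det_le_trace_div_card_pow {P : Matrix ι ι ℝ} (hP : P.PosSemidef)
    [Nonempty ι] : P.det ≤ (P.trace / Fintype.card ι) ^ Fintype.card ι := by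
  have hev := hP.eigenvalues_nonneg
  have hprod : 0 ≤ ∏ i, hP.isHermitian.eigenvalues i := Finset.prod_nonneg fun i _ => hev i
  have h := Real.geom_mean_le_arith_mean Finset.univ (fun _ => 1)
    hP.isHermitian.eigenvalues (by simp) (by simp [Fintype.card_pos]) (fun i _ => hev i)
  simp only [Real.rpow_one, Finset.sum_const, Finset.card_univ, nsmul_eq_mul, mul_one,
    one_mul] at h
  have hpow := pow_le_pow_left₀ (Real.rpow_nonneg hprod _) h (Fintype.card ι)
  rw [Real.rpow_inv_natCast_pow hprod Fintype.card_ne_zero] at hpow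
  rw [hP.isHermitian.det_eq_prod_eigenvalues, hP.isHermitian.trace_eq_sum_eigenvalues]
  exact_mod_cast hpow

open scoped MatrixOrder in
/-- Upper bound on the determinant of the regularized Gram matrix. -/
lemma log_det_ridgeGram_sub_le [Nonempty ι] {S : Matrix ι ι ℝ} (hS : S.PosDef)
    (x : ℕ → ι → ℝ) (n : ℕ) :
    Real.log (ridgeGram S x n).det - Real.log S.det
      ≤ Fintype.card ι * Real.log
        (1 + (∑ j ∈ Finset.range n, x j ⬝ᵥ S⁻¹ *ᵥ x j) / Fintype.card ι) := by
  have hB := ridgeGram_posDef hS x n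
  have hcard : (Fintype.card ι : ℝ) ≠ 0 := by simp
  obtain ⟨C, hC⟩ := CStarAlgebra.nonneg_iff_eq_star_mul_self.mp hS.inv.posSemidef.nonneg
  rw [star_eq_conjTranspose] at hC
  have hP := hB.posSemidef.mul_mul_conjTranspose_same C
  have hdet : (C * ridgeGram S x n * Cᴴ).det = (ridgeGram S x n).det / S.det := by
    rw [det_mul, mul_comm, ← det_mul, ← Matrix.mul_assoc, ← hC, det_mul, det_nonsing_inv,
      Ring.inverse_eq_inv', div_eq_inv_mul]
  have htrace : (C * ridgeGram S x n * Cᴴ).trace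
      = Fintype.card ι + ∑ j ∈ Finset.range n, x j ⬝ᵥ S⁻¹ *ᵥ x j := by
    rw [trace_mul_comm, ← Matrix.mul_assoc, ← hC, ridgeGram, Matrix.mul_add,
      nonsing_inv_mul _ hS.det_pos.ne'.isUnit, trace_add, trace_one, Matrix.mul_sum, trace_sum]
    congr 1
    refine Finset.sum_congr rfl fun j _ => ?_
    rw [mul_vecMulVec, trace_vecMulVec, dotProduct_comm]
  have hle := hP.det_le_trace_div_card_pow
  rw [hdet, htrace, add_div, div_self hcard] at hle
  rw [← Real.log_div hB.det_pos.ne' hS.det_pos.ne', ← Real.log_pow]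
  exact Real.log_le_log (div_pos hB.det_pos hS.det_pos) hle

end RidgeRegression

/-- Pathwise bound on the cumulative squared prediction error of the online
ridge-regression loss predictor: with `M = {m : |⟨x,m⟩| ≤ 1 ∀ x ∈ X}` and
`m_{t,a}` the minimizer of `‖m‖_S² + ∑_{j<t} 1{A_j=a} ⟨θ_{j,a} − m, X_j⟩²`,
`∑_t ⟨θ_{t,A_t} − m_{t,A_t}, X_t⟩² ≤ ∑_t ⟨θ_{t,A_t} − m*, X_t⟩² + K‖m*‖_S²
  + 8Kd log(1 + (T/d) max_t ‖X_t‖²_{S⁻¹})`.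
Rounds are 0-indexed: `t ∈ range T` is the paper's round `t+1`. -/
theorem predictor_squared_error_bound (d K T : ℕ)
    (hd : 1 ≤ d) (hK : 1 ≤ K) (hT : 1 ≤ T)
    (Xset : Set (Fin d → ℝ))
    (M : Set (Fin d → ℝ))
    (hM : M = {m | ∀ x ∈ Xset, |x ⬝ᵥ m| ≤ 1})
    (hMne : M.Nonempty) (hMclosed : IsClosed M)
    (S : Matrix (Fin d) (Fin d) ℝ) (hS : S.PosDef)
    (X : ℕ → Fin d → ℝ) (hX : ∀ t, t < T → X t ∈ Xset)
    (A : ℕ → Fin K) (θ : ℕ → Fin K → Fin d → ℝ)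
    (hθ : ∀ t, t < T → ∀ a, |X t ⬝ᵥ θ t a| ≤ 1)
    (m : ℕ → Fin K → Fin d → ℝ)
    (hm : ∀ t, t < T → ∀ a : Fin K, m t a ∈ M ∧ ∀ m' ∈ M,
        (m t a) ⬝ᵥ S.mulVec (m t a)
            + ∑ j ∈ Finset.range t,
                (if A j = a then (1 : ℝ) else 0) * ((θ j a - m t a) ⬝ᵥ X j) ^ 2
          ≤ m' ⬝ᵥ S.mulVec m'
            + ∑ j ∈ Finset.range t,
                (if A j = a then (1 : ℝ) else 0) * ((θ j a - m') ⬝ᵥ X j) ^ 2) :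
    ∀ mstar ∈ M,
      ∑ t ∈ Finset.range T, ((θ t (A t) - m t (A t)) ⬝ᵥ X t) ^ 2
        ≤ ∑ t ∈ Finset.range T, ((θ t (A t) - mstar) ⬝ᵥ X t) ^ 2
          + K * (mstar ⬝ᵥ S.mulVec mstar)
          + 8 * K * d * Real.log (1 + ((T : ℝ) / d) *
              (Finset.range T).sup'
                (Finset.nonempty_range_iff.mpr (by omega))
                (fun t => X t ⬝ᵥ S⁻¹.mulVec (X t))) := by
  intro mstar hmstar
  have : Nonempty (Fin d) := ⟨⟨0, hd⟩⟩
  have hd0 : (0 : ℝ) < d := by exact_mod_cast hd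
  have hMconv : Convex ℝ M := by
    subst hM
    intro u hu v hv a b ha hb hab z hz
    rw [dotProduct_add, dotProduct_smul, dotProduct_smul, smul_eq_mul, smul_eq_mul]
    have h1 := abs_le.mp (hu z hz)
    have h2 := abs_le.mp (hv z hz)
    rw [abs_le]
    constructor <;> nlinarith
  set V := (Finset.range T).sup' (Finset.nonempty_range_iff.mpr (by omega))
    (fun t => X t ⬝ᵥ S⁻¹.mulVec (X t)) with hV
  have hXnonneg : ∀ v : Fin d → ℝ, 0 ≤ v ⬝ᵥ S⁻¹ *ᵥ v := fun v => by
    simpa using hS.inv.posSemidef.dotProduct_mulVec_nonneg v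
  have hXV : ∀ t < T, X t ⬝ᵥ S⁻¹ *ᵥ X t ≤ V := fun t ht =>
    Finset.le_sup' (fun t => X t ⬝ᵥ S⁻¹ *ᵥ X t) (Finset.mem_range.mpr ht)
  have hV0 : 0 ≤ V := (hXnonneg (X 0)).trans (hXV 0 hT)
  have hlog0 : 0 ≤ Real.log (1 + (T : ℝ) / d * V) :=
    Real.log_nonneg (le_add_of_nonneg_right (by positivity))
  have hterm : ∀ (a : Fin K) (j : ℕ) (v : Fin d → ℝ),
      ((if A j = a then θ j a ⬝ᵥ X j else 0) - v ⬝ᵥ (if A j = a then X j else 0)) ^ 2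
        = (if A j = a then (1 : ℝ) else 0) * ((θ j a - v) ⬝ᵥ X j) ^ 2 := fun a j v => by
    split_ifs <;> simp [sub_dotProduct]
  have haction : ∀ a : Fin K,
      ∑ t ∈ Finset.range T, (if A t = a then (1 : ℝ) else 0) * ((θ t a - m t a) ⬝ᵥ X t) ^ 2
        ≤ mstar ⬝ᵥ S *ᵥ mstar + ∑ t ∈ Finset.range T,
            (if A t = a then (1 : ℝ) else 0) * ((θ t a - mstar) ⬝ᵥ X t) ^ 2
          + 8 * (d * Real.log (1 + (T : ℝ) / d * V)) := fun a => by
    have hregret := sum_sq_residual_le_ridgeObjective_add_log_det hMconv hS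
      (x := fun j => if A j = a then X j else 0)
      (y := fun j => if A j = a then θ j a ⬝ᵥ X j else 0) (n := T) (p := fun t => m t a)
      (R := 4) (fun t ht => (hm t ht a).1)
      (fun t ht => isMinOn_iff.mpr fun m' hm' => by
        simpa only [ridgeObjective, hterm] using (hm t ht a).2 m' hm')
      (fun t ht => by
        have h1 := abs_le.mp (hθ t ht a)
        have hmem := (hm t ht a).1
        rw [hM] at hmem
        have h2 := abs_le.mp (hmem (X t) (hX t ht))
        rw [hterm, sub_dotProduct, dotProduct_comm (θ t a), dotProduct_comm (m t a)]
        split_ifs <;> nlinarith) hmstar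
    simp only [ridgeObjective, hterm] at hregret
    have hdet := log_det_ridgeGram_sub_le hS (fun j => if A j = a then X j else 0) T
    rw [Fintype.card_fin] at hdet
    have hsum : ∑ j ∈ Finset.range T,
        (if A j = a then X j else 0) ⬝ᵥ S⁻¹ *ᵥ (if A j = a then X j else 0) ≤ T * V := by
      calc _ ≤ ∑ j ∈ Finset.range T, V := Finset.sum_le_sum fun j hj => by
            split_ifs
            · exact hXV j (Finset.mem_range.mp hj)
            · simpa using hV0
        _ = T * V := by simp
    have hlog : Real.log (1 + (∑ j ∈ Finset.range T,
          (if A j = a then X j else 0) ⬝ᵥ S⁻¹ *ᵥ (if A j = a then X j else 0)) / d)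
        ≤ Real.log (1 + (T : ℝ) / d * V) := by
      refine Real.log_le_log ?_ ?_
      · have := Finset.sum_nonneg fun j (_ : j ∈ Finset.range T) =>
          hXnonneg (if A j = a then X j else 0)
        positivity
      · rw [div_mul_eq_mul_div]
        gcongr
    have hdlog := mul_le_mul_of_nonneg_left hlog hd0.le
    have hdlog0 := mul_nonneg hd0.le hlog0
    linarith
  have hcollapse : ∀ f : ℕ → Fin K → ℝ,
      ∑ a, ∑ t ∈ Finset.range T, (if A t = a then (1 : ℝ) else 0) * f t a
        = ∑ t ∈ Finset.range T, f t (A t) := fun f => by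
    rw [Finset.sum_comm]
    simp
  have hsum := Finset.sum_le_sum fun a (_ : a ∈ Finset.univ) => haction a
  rw [Finset.sum_add_distrib, Finset.sum_add_distrib,
    hcollapse fun t a => ((θ t a - m t a) ⬝ᵥ X t) ^ 2,
    hcollapse fun t a => ((θ t a - mstar) ⬝ᵥ X t) ^ 2] at hsum
  simp only [Finset.sum_const, Finset.card_univ, Fintype.card_fin, nsmul_eq_mul] at hsum
  linarith
end
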